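/- Let μ > 0 and c_μ = 2^{1/2} μ^{1/6}. For every z ∈ ℝ, ∫_ℝ c_μ K_Ai(−c_μ y/2, c_μ y/2) e^{izy} dy = Ai₁(z²/(2μ)^{1/3}). -/

import Mathlib

open MeasureTheory Filter

/-- Airy function via the contour integral along `Re ζ = 1`:
`Ai(z) = (1/(2πi)) ∫ e^{ζ³/3 - zζ} dζ`, parametrised by `ζ = 1 + it`. -/
noncomputable def AiryC (z : ℂ) : ℂ :=
  (1 / (2 * (Real.pi : ℂ))) *
    ∫ t : ℝ, Complex.exp ((1 + (t:ℂ)*Complex.I)^3/3 - z*(1 + (t:ℂ)*Complex.I))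

/-- The Airy function on the real line (real-valued). -/
noncomputable def AiryR (x : ℝ) : ℝ := (AiryC (x:ℂ)).re

/-- Integrated Airy function `Ai₁(ξ) = ∫_ξ^∞ Ai(u) du`. -/
noncomputable def Ai1 (ξ : ℝ) : ℝ := ∫ u in Set.Ioi ξ, AiryR u

/-- The Airy kernel `K_Ai(u,v) = ∫_0^∞ Ai(u+λ)Ai(v+λ) dλ` on the real line. -/
noncomputable def KAiryR (u v : ℝ) : ℝ :=
  ∫ l in Set.Ioi (0:ℝ), AiryR (u + l) * AiryR (v + l)

/-- The edge constant `c_μ = 2^{1/2} μ^{1/6}`. -/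
noncomputable def cEdge (μ : ℝ) : ℝ := Real.sqrt 2 * μ ^ ((1:ℝ)/6)

namespace AiryAux

open Complex

/-- the integrand -/
noncomputable def sg (p : ℝ) : ℂ := 1 + (p:ℂ) * I

lemma sg_re (p : ℝ) : (sg p).re = 1 := by simp [sg]
lemma sg_im (p : ℝ) : (sg p).im = p := by simp [sg]
lemma sg_ne (p : ℝ) : sg p ≠ 0 := by
  intro h
  have := sg_re p
  rw [h] at this
  simp at this

lemma continuous_sg : Continuous sg := by unfold sg; fun_prop

lemma sg_norm (p : ℝ) : 1 ≤ ‖sg p‖ := by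
  have := Complex.abs_re_le_norm (sg p)
  rw [sg_re] at this
  simpa using this

lemma cube_re (ζ : ℂ) : (ζ^3).re = ζ.re^3 - 3 * ζ.re * ζ.im^2 := by
  simp [pow_succ]
  ring

lemma sg_cube_re (p : ℝ) : ((sg p)^3).re = 1 - 3 * p^2 := by
  rw [cube_re, sg_re, sg_im]; ring

/-- unnormalised Airy -/
noncomputable def A (x : ℝ) : ℂ := ∫ t : ℝ, cexp ((sg t)^3/3 - (x:ℂ) * sg t)

lemma div3_re (w : ℂ) : (w/3).re = w.re/3 := by
  simp

lemma norm_integrand (x t : ℝ) :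
    ‖cexp ((sg t)^3/3 - (x:ℂ) * sg t)‖ = Real.exp (1/3 - x) * Real.exp (-1 * t^2) := by
  rw [Complex.norm_exp, ← Real.exp_add]
  congr 1
  rw [Complex.sub_re, div3_re, sg_cube_re, Complex.re_ofReal_mul, sg_re]
  ring

lemma integrable_integrand (x : ℝ) :
    Integrable (fun t : ℝ => cexp ((sg t)^3/3 - (x:ℂ) * sg t)) := by
  have h := (integrable_exp_neg_mul_sq (b := 1) one_pos).const_mul (Real.exp (1/3 - x))
  refine h.mono' ?_ (Eventually.of_forall fun t => (norm_integrand x t).le)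
  have := continuous_sg
  exact Continuous.aestronglyMeasurable (by fun_prop)

lemma airyC_eq (x : ℝ) : AiryC x = (1 / (2 * (Real.pi : ℂ))) * A x := rfl

lemma A_conj (x : ℝ) : (starRingEnd ℂ) (A x) = A x := by
  unfold A
  rw [← integral_conj, ← integral_neg_eq_self]
  congr 1
  ext t
  rw [← Complex.exp_conj]
  congr 1
  simp [sg, map_ofNat (starRingEnd ℂ)]

lemma airyR_eq (x : ℝ) : ((AiryR x : ℝ) : ℂ) = (1 / (2 * (Real.pi : ℂ))) * A x := by
  unfold AiryR
  rw [← airyC_eq]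
  apply Complex.conj_eq_iff_re.mp
  rw [airyC_eq, map_mul, A_conj]
  simp [map_ofNat (starRingEnd ℂ)]

/-! ### Gaussian root factor -/

noncomputable def S (p : ℝ) : ℂ := ((Real.pi : ℂ) / (2 * sg p)) ^ (1/2 : ℂ)

lemma inv_sg_re (p : ℝ) : 0 < ((sg p)⁻¹).re := by
  rw [Complex.inv_re, sg_re]
  have : 0 < normSq (sg p) := Complex.normSq_pos.mpr (sg_ne p)
  positivity

lemma S_arg_re (p : ℝ) : 0 < ((Real.pi : ℂ) / (2 * sg p)).re := by
  have : (Real.pi : ℂ) / (2 * sg p) = ((Real.pi / 2 : ℝ) : ℂ) * (sg p)⁻¹ := by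
    push_cast; field_simp
  rw [this, Complex.re_ofReal_mul]
  exact mul_pos (by positivity) (inv_sg_re p)

lemma continuous_S : Continuous S := by
  unfold S
  refine Continuous.cpow ?_ continuous_const fun p => Or.inl (S_arg_re p)
  exact Continuous.div continuous_const (continuous_const.mul continuous_sg)
    fun p => mul_ne_zero two_ne_zero (sg_ne p)

lemma S_sq (p : ℝ) : (S p)^2 = (Real.pi : ℂ) / (2 * sg p) := by
  have := Complex.cpow_nat_inv_pow ((Real.pi : ℂ) / (2 * sg p)) (n := 2) two_ne_zero
  rw [← this]
  simp [S]

lemma S_norm (p : ℝ) : ‖S p‖ ≤ 2 := by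
  have h : ‖S p‖^2 ≤ 4 := by
    rw [← norm_pow, S_sq, norm_div, norm_mul]
    have h1 := sg_norm p
    have h3 : 0 < ‖sg p‖ := by linarith
    have h2 := Real.pi_le_four
    rw [div_le_iff₀ (mul_pos (by simp) h3)]
    simp [abs_of_pos Real.pi_pos]
    linarith
  nlinarith [norm_nonneg (S p)]

lemma mul_cpow' {a b r : ℂ} (ha : a ≠ 0) (hb : b ≠ 0)
    (h : a.arg + b.arg ∈ Set.Ioc (-Real.pi) Real.pi) : (a * b) ^ r = a ^ r * b ^ r := by
  rw [Complex.cpow_def_of_ne_zero ha, Complex.cpow_def_of_ne_zero hb,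
    Complex.cpow_def_of_ne_zero (mul_ne_zero ha hb), Complex.log_mul_eq_add_log_iff ha hb |>.mpr h,
    ← Complex.exp_add]
  congr 1; ring

lemma S_mul (p : ℝ) : S p * ((Real.pi : ℂ) / (1 / (8 * sg p))) ^ (1/2 : ℂ) = 2 * Real.pi := by
  have e : (Real.pi : ℂ) / (1 / (8 * sg p)) = ((8 * Real.pi : ℝ) : ℂ) * sg p := by
    push_cast; field_simp
  have hpos : 0 < ((Real.pi : ℂ) / (1 / (8 * sg p))).re := by
    rw [e, Complex.re_ofReal_mul, sg_re]; positivity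
  have h1 : |((Real.pi : ℂ) / (2 * sg p)).arg| < Real.pi / 2 :=
    Complex.abs_arg_lt_pi_div_two_iff.mpr (Or.inl (S_arg_re p))
  have h2 : |((Real.pi : ℂ) / (1 / (8 * sg p))).arg| < Real.pi / 2 :=
    Complex.abs_arg_lt_pi_div_two_iff.mpr (Or.inl hpos)
  rw [abs_lt] at h1 h2
  unfold S
  rw [← mul_cpow']
  · have : (Real.pi : ℂ) / (2 * sg p) * ((Real.pi : ℂ) / (1 / (8 * sg p))) = (2 * Real.pi)^2 := by
      have := sg_ne p
      field_simp
      ring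
    rw [this, one_div, Complex.sq_cpow_two_inv]
    simp [Real.pi_pos]
  · intro h; have := S_arg_re p; rw [h] at this; simp at this
  · intro h; rw [h] at hpos; simp at hpos
  · constructor <;> linarith [h1.1, h1.2, h2.1, h2.2]

/-! ### Product formula -/

lemma A_mul (l w : ℝ) : A (l - w/2) * A (l + w/2)
    = 2 * ∫ p : ℝ, cexp (2 * (sg p)^3/3 - 2 * l * sg p) * (S p * cexp (-(w:ℂ)^2 / (8 * sg p))) := by
  have hc := continuous_sg
  set F : ℝ → ℝ → ℂ := fun t s => cexp ((sg t)^3/3 - ((l - w/2 : ℝ):ℂ) * sg t) *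
    cexp ((sg s)^3/3 - ((l + w/2 : ℝ):ℂ) * sg s) with hF
  have h1 : A (l - w/2) * A (l + w/2) = ∫ t, ∫ s, F t s := by
    simp only [hF, integral_const_mul, integral_mul_const]
    rfl
  have h2 : ∀ t, ∫ s, F t s = 2 * ∫ p, F t (2 * p - t) := by
    intro t
    have := Measure.integral_comp_mul_left (fun x => F t (x - t)) 2
    rw [this, integral_sub_right_eq_self (fun x => F t x) t]
    simp
  have hFint : Integrable (Function.uncurry fun t p => F t (2 * p - t)) (volume.prod volume) := by
    have hg := ((integrable_exp_neg_mul_sq (b := 1/2) (by norm_num)).mul_prod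
      (integrable_exp_neg_mul_sq (b := 1/2) (by norm_num))).const_mul
        (Real.exp (1/3 - (l - w/2)) * Real.exp (1/3 - (l+w/2)))
    refine hg.mono' ?_ (Eventually.of_forall ?_)
    · apply Continuous.aestronglyMeasurable
      simp only [hF, Function.uncurry_def]
      fun_prop
    · rintro ⟨t, p⟩
      simp only [hF, Function.uncurry_apply_pair, norm_mul, norm_integrand]
      rw [mul_mul_mul_comm]
      refine mul_le_mul_of_nonneg_left ?_ (by positivity)
      rw [← Real.exp_add, ← Real.exp_add]
      apply Real.exp_le_exp.mpr
      nlinarith [sq_nonneg (t - p), sq_nonneg (2*t-3*p), sq_nonneg (3*t-4*p)]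
  rw [h1]
  simp only [h2]
  rw [integral_const_mul, integral_integral_swap hFint]
  congr 2
  ext p
  rw [← integral_add_left_eq_self _ p]
  have hb : 0 < (2 * sg p).re := by simp [sg_re]
  have hG := fourierIntegral_gaussian hb (w:ℂ)
  have e : ∀ q : ℝ, F (p + q) (2 * p - (p + q)) = cexp (2 * (sg p)^3/3 - 2 * l * sg p) *
      (cexp (I * w * q) * cexp (-(2 * sg p) * (q:ℂ)^2)) := by
    intro q
    simp only [hF]
    rw [← Complex.exp_add, ← Complex.exp_add, ← Complex.exp_add]
    congr 1
    have a1 : sg (p + q) = sg p + q * I := by simp [sg]; ring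
    have a2 : sg (2 * p - (p + q)) = sg p - q * I := by simp [sg]; ring
    rw [a1, a2]
    push_cast
    have : (I:ℂ)^2 = -1 := Complex.I_sq
    linear_combination (2 * sg p * (q:ℂ)^2) * this
  simp only [e]
  rw [integral_const_mul, hG]
  congr 2
  rw [show (4:ℂ) * (2 * sg p) = 8 * sg p by ring]

lemma norm_exp2 (p : ℝ) : ‖cexp (2 * (sg p)^3/3)‖ = Real.exp (2/3) * Real.exp (-2 * p^2) := by
  rw [Complex.norm_exp, ← Real.exp_add]
  congr 1
  rw [div3_re, show (2:ℂ) = ((2:ℝ):ℂ) by simp, Complex.re_ofReal_mul, sg_cube_re]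
  ring

lemma gauss_re (p w : ℝ) : (-(w:ℂ)^2 / (8 * sg p)).re = -(w^2 / (8 * (1 + p^2))) := by
  have : -(w:ℂ)^2 / (8 * sg p) = ((-(w^2)/8 : ℝ) : ℂ) * (sg p)⁻¹ := by
    push_cast; field_simp
  rw [this, Complex.re_ofReal_mul, Complex.inv_re, Complex.normSq_apply, sg_re, sg_im]
  have : (1 + p^2) ≠ 0 := by positivity
  rw [show (1:ℝ) * 1 + p * p = 1 + p^2 by ring]
  field_simp

lemma norm_gauss (p w : ℝ) : ‖cexp (-(w:ℂ)^2 / (8 * sg p))‖ = Real.exp (-(w^2 / (8 * (1 + p^2)))) := by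
  rw [Complex.norm_exp, gauss_re]

lemma norm_gauss_le_one (p w : ℝ) : ‖cexp (-(w:ℂ)^2 / (8 * sg p))‖ ≤ 1 := by
  rw [norm_gauss, Real.exp_le_one_iff]
  have : 0 ≤ w^2 / (8 * (1 + p^2)) := by positivity
  linarith

lemma norm_gauss_le (p w : ℝ) :
    ‖cexp (-(w:ℂ)^2 / (8 * sg p))‖ ≤ 8 * (1 + p^2) * (1 + w^2)⁻¹ := by
  rw [norm_gauss, Real.exp_neg]
  have h1 := Real.add_one_le_exp (w^2 / (8 * (1 + p^2)))
  have h2 : (1 + w^2) / (8 * (1 + p^2)) ≤ Real.exp (w^2 / (8 * (1 + p^2))) := by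
    refine le_trans ?_ h1
    rw [add_div, add_comm]
    gcongr
    rw [div_le_one (by positivity)]
    nlinarith [sq_nonneg p]
  calc _ ≤ ((1 + w^2) / (8 * (1 + p^2)))⁻¹ := inv_anti₀ (by positivity) h2
    _ = _ := by rw [inv_div, div_eq_mul_inv]

noncomputable def Q (w p : ℝ) : ℂ := cexp (2 * (sg p)^3/3) / sg p * (S p * cexp (-(w:ℂ)^2 / (8 * sg p)))

lemma K_eq (w : ℝ) : ((KAiryR (-(w/2)) (w/2) : ℝ) : ℂ) = (1 / (2 * (Real.pi : ℂ)))^2 * ∫ p, Q w p := by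
  have hc := continuous_sg
  have hS := continuous_S
  unfold KAiryR
  rw [← integral_complex_ofReal]
  have e : ∀ l : ℝ, ((AiryR (-(w/2) + l) * AiryR (w/2 + l) : ℝ) : ℂ) = (1 / (2 * (Real.pi : ℂ)))^2 *
      (2 * ∫ p : ℝ, cexp (2 * (sg p)^3/3 - 2 * l * sg p) * (S p * cexp (-(w:ℂ)^2 / (8 * sg p)))) := by
    intro l
    rw [← A_mul, Complex.ofReal_mul, airyR_eq, airyR_eq, show -(w/2) + l = l - w/2 by ring,
      show w/2 + l = l + w/2 by ring]
    ring
  simp only [e]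
  rw [integral_const_mul, integral_const_mul, integral_integral_swap, ← integral_const_mul]
  · congr 2
    ext p
    have e2 : ∀ l : ℝ, cexp (2 * (sg p)^3/3 - 2 * l * sg p) * (S p * cexp (-(w:ℂ)^2 / (8 * sg p)))
        = cexp (2 * (sg p)^3/3) * (S p * cexp (-(w:ℂ)^2 / (8 * sg p))) * cexp (-(2 * sg p) * l) := by
      intro l
      rw [sub_eq_add_neg, Complex.exp_add]
      ring_nf
    simp only [e2]
    rw [integral_const_mul, integral_exp_mul_complex_Ioi (by simp [sg_re])]
    have := sg_ne p
    simp only [Q, ofReal_zero, mul_zero, Complex.exp_zero]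
    field_simp
  · have hg := ((exp_neg_integrableOn_Ioi 0 (b := 2) two_pos).integrable.mul_prod
      (integrable_exp_neg_mul_sq (b := 2) (by norm_num))).const_mul (Real.exp (2/3) * 2)
    refine hg.mono' ?_ (Eventually.of_forall ?_)
    · apply Continuous.aestronglyMeasurable
      simp only [Function.uncurry_def]
      have : ∀ p : ℝ × ℝ, 8 * sg p.2 ≠ 0 := fun p => mul_ne_zero (by norm_num) (sg_ne _)
      fun_prop (disch := assumption)
    · rintro ⟨l, p⟩
      simp only [Function.uncurry_apply_pair, norm_mul]
      have e3 : ‖cexp (2 * (sg p)^3/3 - 2 * l * sg p)‖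
          = Real.exp (2/3) * (Real.exp (-2 * l) * Real.exp (-2 * p^2)) := by
        rw [sub_eq_add_neg, Complex.exp_add, norm_mul, norm_exp2, Complex.norm_exp]
        have : (-(2 * (l:ℂ) * sg p)).re = -2 * l := by
          simp [sg_re]
        rw [this]; ring
      rw [e3]
      have h1 := S_norm p
      have h2 := norm_gauss_le_one p w
      have : ‖S p‖ * ‖cexp (-(w:ℂ)^2 / (8 * sg p))‖ ≤ 2 * 1 := by gcongr
      calc _ ≤ Real.exp (2/3) * (Real.exp (-2 * l) * Real.exp (-2 * p^2)) * (2 * 1) := by gcongr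
        _ = _ := by ring

lemma fourier_K (s : ℝ) : (∫ w : ℝ, ((KAiryR (-(w/2)) (w/2) : ℝ) : ℂ) * cexp (I * s * w))
    = (1 / (2 * (Real.pi : ℂ))) * ∫ p : ℝ, cexp (2 * (sg p)^3/3 - 2 * s^2 * sg p) / sg p := by
  have hc := continuous_sg
  have hS := continuous_S
  have e : ∀ w : ℝ, ((KAiryR (-(w/2)) (w/2) : ℝ) : ℂ) * cexp (I * s * w)
     = (1 / (2 * (Real.pi : ℂ)))^2 * ∫ p, cexp (I * s * w) * Q w p := by
    intro w
    rw [K_eq, integral_const_mul]; ring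
  simp only [e]
  rw [integral_const_mul, integral_integral_swap]
  · have e2 : ∀ p : ℝ, ∫ w : ℝ, cexp (I * s * w) * Q w p =
       2 * Real.pi * (cexp (2 * (sg p)^3/3 - 2 * s^2 * sg p) / sg p) := by
      intro p
      have hs := sg_ne p
      have hb : 0 < (1 / (8 * sg p)).re := by
        have : 1 / (8 * sg p) = ((1/8 : ℝ) : ℂ) * (sg p)⁻¹ := by
          push_cast; field_simp
        rw [this, Complex.re_ofReal_mul]
        exact mul_pos (by norm_num) (inv_sg_re p)
      have hG := fourierIntegral_gaussian hb (s:ℂ)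
      have e3 : ∀ w : ℝ, cexp (I * s * w) * Q w p = cexp (2 * (sg p)^3/3) / sg p * S p *
          (cexp (I * s * w) * cexp (-(1 / (8 * sg p)) * (w:ℂ)^2)) := by
        intro w
        rw [show -(1 / (8 * sg p)) * (w:ℂ)^2 = -(w:ℂ)^2 / (8 * sg p) by ring]
        unfold Q; ring
      simp only [e3]
      rw [integral_const_mul, hG, sub_eq_add_neg, Complex.exp_add, ← S_mul p]
      rw [show -(s:ℂ)^2 / (4 * (1 / (8 * sg p))) = -(2 * s^2 * sg p) by field_simp; ring]
      ring
    simp only [e2]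
    rw [integral_const_mul]
    have : (Real.pi : ℂ) ≠ 0 := by simp
    field_simp
  · have hg := (integrable_inv_one_add_sq.mul_prod
      (integrable_exp_neg_mul_sq (b := 1) one_pos)).const_mul (Real.exp (2/3) * 16)
    refine hg.mono' ?_ (Eventually.of_forall ?_)
    · apply Continuous.aestronglyMeasurable
      simp only [Function.uncurry_def, Q]
      have : ∀ p : ℝ × ℝ, 8 * sg p.2 ≠ 0 := fun p => mul_ne_zero (by norm_num) (sg_ne _)
      have : ∀ p : ℝ × ℝ, sg p.2 ≠ 0 := fun p => sg_ne _
      fun_prop (disch := assumption)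
    · rintro ⟨w, p⟩
      have e1 : ‖cexp (I * s * w)‖ = 1 := by
        rw [Complex.norm_exp]; simp
      simp only [Function.uncurry_apply_pair, norm_mul, Q, norm_div, e1, one_mul, norm_exp2]
      have h1 := S_norm p
      have h2 := norm_gauss_le p w
      have h3 : Real.exp (2/3) * Real.exp (-2 * p^2) / ‖sg p‖ ≤ Real.exp (2/3) * Real.exp (-2 * p^2) :=
        div_le_self (by positivity) (sg_norm p)
      have h4 : Real.exp (-2 * p^2) * (1 + p^2) ≤ Real.exp (-1 * p^2) := by
        have : Real.exp (-1 * p^2) = Real.exp (-2 * p^2) * Real.exp (p^2) := by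
          rw [← Real.exp_add]; congr 1; ring
        rw [this]
        gcongr
        linarith [Real.add_one_le_exp (p^2)]
      calc _ ≤ (Real.exp (2/3) * Real.exp (-2 * p^2)) * (2 * (8 * (1 + p^2) * (1 + w^2)⁻¹)) := by
            gcongr
        _ = Real.exp (2/3) * 16 * ((1 + w^2)⁻¹ * (Real.exp (-2 * p^2) * (1 + p^2))) := by ring
        _ ≤ _ := by gcongr

/-! ### Integrated Airy function -/

noncomputable def f (ξ : ℝ) (ζ : ℂ) : ℂ := cexp (ζ^3/3 - ξ * ζ) / ζ

lemma Ai1_eq (ξ : ℝ) : ((Ai1 ξ : ℝ) : ℂ) = (1 / (2 * (Real.pi : ℂ))) * ∫ t, f ξ (sg t) := by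
  have hc := continuous_sg
  unfold Ai1
  rw [← integral_complex_ofReal]
  simp only [airyR_eq]
  rw [integral_const_mul]
  unfold A
  rw [integral_integral_swap]
  · congr 2
    ext t
    have e2 : ∀ u : ℝ, cexp ((sg t)^3/3 - u * sg t) = cexp ((sg t)^3/3) * cexp (-(sg t) * u) := by
      intro u
      rw [← Complex.exp_add]; congr 1; ring
    simp only [e2]
    rw [integral_const_mul, integral_exp_mul_complex_Ioi (by simp [sg_re])]
    have := sg_ne t
    rw [neg_div_neg_eq, ← mul_div_assoc, ← Complex.exp_add, f]
    congr 2; ring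
  · have hg := ((exp_neg_integrableOn_Ioi ξ (b := 1) one_pos).integrable.mul_prod
      (integrable_exp_neg_mul_sq (b := 1) one_pos)).const_mul (Real.exp (1/3))
    refine hg.mono' ?_ (Eventually.of_forall ?_)
    · apply Continuous.aestronglyMeasurable
      simp only [Function.uncurry_def]
      fun_prop
    · rintro ⟨u, t⟩
      simp only [Function.uncurry_apply_pair, norm_integrand]
      rw [sub_eq_add_neg, Real.exp_add]
      apply le_of_eq
      ring_nf

lemma f_bound (ξ x y : ℝ) (h1 : 1 ≤ x) (h2 : x ≤ 2) :
    ‖f ξ (x + y * I)‖ ≤ Real.exp (8/3 + 2 * |ξ|) * Real.exp (-1 * y^2) := by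
  have hre : ((x:ℂ) + y * I).re = x := by simp
  have him : ((x:ℂ) + y * I).im = y := by simp
  have hn : 1 ≤ ‖(x:ℂ) + y * I‖ := by
    have := Complex.abs_re_le_norm ((x:ℂ) + y * I)
    rw [hre] at this
    linarith [le_abs_self x]
  rw [f, norm_div]
  refine (div_le_self (norm_nonneg _) hn).trans ?_
  rw [Complex.norm_exp, ← Real.exp_add, Real.exp_le_exp, Complex.sub_re, div3_re, cube_re,
    Complex.re_ofReal_mul, hre, him]
  have a1 : x^3 ≤ 2^3 := by gcongr
  have a2 : -(ξ * x) ≤ 2 * |ξ| := by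
    calc -(ξ * x) ≤ |ξ * x| := neg_le_abs _
      _ = |ξ| * x := by rw [abs_mul, abs_of_nonneg (by linarith : 0 ≤ x)]
      _ ≤ _ := by nlinarith [abs_nonneg ξ]
  nlinarith [sq_nonneg y]

lemma f_integrable (ξ x : ℝ) (h1 : 1 ≤ x) (h2 : x ≤ 2) :
    Integrable (fun y : ℝ => f ξ (x + y * I)) := by
  have h := (integrable_exp_neg_mul_sq (b := 1) one_pos).const_mul (Real.exp (8/3 + 2 * |ξ|))
  refine h.mono' ?_ (Eventually.of_forall fun t => f_bound ξ x t h1 h2)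
  have : ∀ y : ℝ, (x:ℂ) + y * I ≠ 0 := by
    intro y hy
    have := congrArg Complex.re hy
    simp at this
    linarith
  apply Continuous.aestronglyMeasurable
  unfold f
  fun_prop (disch := assumption)

lemma shift (ξ k : ℝ) (h1 : 1 ≤ k) (h2 : k ≤ 2) :
    ∫ y : ℝ, f ξ (k + y * I) = ∫ y : ℝ, f ξ (sg y) := by
  have hlim : Tendsto (fun T : ℝ => Real.exp (8/3 + 2 * |ξ|) * Real.exp (-1 * T^2) * |k - 1|)
      atTop (nhds 0) := by
    have : Tendsto (fun T : ℝ => Real.exp (-1 * T^2)) atTop (nhds 0) := by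
      apply Real.tendsto_exp_atBot.comp
      have := tendsto_neg_atTop_atBot.comp (tendsto_pow_atTop (α := ℝ) two_ne_zero)
      refine this.congr fun x => ?_
      simp
    simpa using (this.const_mul (Real.exp (8/3 + 2 * |ξ|))).mul_const |k - 1|
  have hor : ∀ g : ℝ → ℝ, (∀ T, (g T)^2 = T^2) →
      Tendsto (fun T : ℝ => ∫ x in (1:ℝ)..k, f ξ (x + g T * I)) atTop (nhds 0) := by
    intro g hg
    refine squeeze_zero_norm (fun T => ?_) hlim
    refine intervalIntegral.norm_integral_le_of_norm_le_const fun x hx => ?_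
    rw [Set.uIoc_of_le h1] at hx
    rw [← hg T]
    exact f_bound ξ x (g T) hx.1.le (hx.2.trans h2)
  have hA := hor (fun T => -T) (fun T => by ring)
  have hB := hor (fun T => T) (fun T => rfl)
  have hC := intervalIntegral_tendsto_integral (f_integrable ξ k h1 h2)
    tendsto_neg_atTop_atBot tendsto_id
  have hD := intervalIntegral_tendsto_integral (f_integrable ξ 1 le_rfl one_le_two)
    tendsto_neg_atTop_atBot tendsto_id
  have hz := ((hA.sub hB).add (hC.const_smul I)).sub (hD.const_smul I)
  have h0 : ∀ T : ℝ, (((∫ x in (1:ℝ)..k, f ξ (x + (-T : ℝ) * I)) - ∫ x in (1:ℝ)..k, f ξ (x + T * I)) +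
      I • ∫ y in (-T)..(id T), f ξ (k + y * I)) - I • ∫ y in (-T)..(id T), f ξ ((1:ℝ) + y * I) = 0 := by
    intro T
    have := Complex.integral_boundary_rect_eq_zero_of_differentiableOn (f ξ) (⟨1, -T⟩ : ℂ) ⟨k, T⟩ ?_
    · simpa using this
    · intro ζ hζ
      have hζ1 : 1 ≤ ζ.re := by
        have := hζ.1
        simp only [Set.mem_preimage, Set.uIcc_of_le h1] at this
        exact this.1
      have hne : ζ ≠ 0 := by
        rintro rfl
        simp at hζ1
        linarith
      apply DifferentiableAt.differentiableWithinAt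
      unfold f
      fun_prop (disch := assumption)
  have hz' := tendsto_nhds_unique (hz.congr h0) tendsto_const_nhds
  simp only [sub_zero, zero_add, smul_eq_mul, ofReal_one] at hz'
  have := mul_left_cancel₀ I_ne_zero (sub_eq_zero.mp hz')
  simpa [sg] using this

lemma H_eq (s k : ℝ) (hk0 : 0 < k) (hk : k^3 = 2) :
    (1 / (2 * (Real.pi : ℂ))) * ∫ p : ℝ, cexp (2 * (sg p)^3/3 - 2 * s^2 * sg p) / sg p
      = ((Ai1 (k^2 * s^2) : ℝ) : ℂ) := by
  have h1 : 1 ≤ k := by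
    by_contra h
    push Not at h
    have : k^3 < 1 := pow_lt_one₀ hk0.le h (by norm_num)
    linarith
  have h2 : k ≤ 2 := by
    by_contra h
    push Not at h
    have : 2^3 < k^3 := by gcongr
    linarith
  rw [Ai1_eq, ← shift _ k h1 h2]
  congr 1
  have := Measure.integral_comp_mul_left (fun y : ℝ => f (k^2 * s^2) (k + y * I)) k
  rw [abs_of_pos (inv_pos.mpr hk0)] at this
  have e : ∀ p : ℝ, cexp (2 * (sg p)^3/3 - 2 * s^2 * sg p) / sg p
      = (k:ℂ) * f (k^2 * s^2) (k + (k * p : ℝ) * I) := by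
    intro p
    have hk' : (k:ℂ)^3 = 2 := by exact_mod_cast hk
    have hkn : (k:ℂ) ≠ 0 := by exact_mod_cast hk0.ne'
    have e1 : (k:ℂ) + (k * p : ℝ) * I = k * sg p := by unfold sg; push_cast; ring
    rw [e1, f, ← hk']
    have := sg_ne p
    have e2 : (k:ℂ)^3 * (sg p)^3/3 - (k:ℂ)^3 * s^2 * sg p =
      (k * sg p)^3/3 - ((k^2 * s^2 : ℝ):ℂ) * (k * sg p) := by push_cast; ring
    rw [e2]
    field_simp
  simp only [e]
  rw [integral_const_mul, this]
  have hkn : (k:ℂ) ≠ 0 := by exact_mod_cast hk0.ne'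
  rw [Complex.real_smul, ← mul_assoc, Complex.ofReal_inv, mul_inv_cancel₀ hkn, one_mul]

end AiryAux

/-- Fourier transform of the Airy kernel on the antidiagonal:
`∫ c_μ K_Ai(-c_μ y/2, c_μ y/2) e^{izy} dy = Ai₁(z²/(2μ)^{1/3})`. -/
theorem fourier_airy_kernel_antidiagonal (μ : ℝ) (hμ : 0 < μ) (z : ℝ) :
    (∫ y : ℝ, ((cEdge μ * KAiryR (-(cEdge μ) * y / 2) (cEdge μ * y / 2) : ℝ) : ℂ) *
        Complex.exp (Complex.I * (z:ℂ) * (y:ℂ)))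
      = ((Ai1 (z^2 / (2*μ) ^ ((1:ℝ)/3)) : ℝ) : ℂ) := by
  have hc : 0 < cEdge μ := by unfold cEdge; positivity
  set c := cEdge μ with hcdef
  set k : ℝ := 2 ^ ((1:ℝ)/3) with hkdef
  have hk0 : 0 < k := by positivity
  have hk : k^3 = 2 := by
    rw [hkdef, ← Real.rpow_natCast, ← Real.rpow_mul (by norm_num)]
    norm_num
  have hcsq : c^2 = 2 * μ ^ ((1:ℝ)/3) := by
    rw [hcdef, cEdge, mul_pow, Real.sq_sqrt (by norm_num), ← Real.rpow_natCast, ← Real.rpow_mul hμ.le]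
    norm_num
  have harg : z^2 / (2*μ) ^ ((1:ℝ)/3) = k^2 * (z/c)^2 := by
    rw [Real.mul_rpow (by norm_num) hμ.le, div_pow, hcsq, ← hkdef]
    have hm : 0 < μ ^ ((1:ℝ)/3) := by positivity
    field_simp
    rw [hk]
  rw [harg, ← AiryAux.H_eq (z/c) k hk0 hk]
  have hF := AiryAux.fourier_K (z/c)
  rw [← hF]
  have hs := Measure.integral_comp_mul_left (fun w : ℝ => ((KAiryR (-(w/2)) (w/2) : ℝ) : ℂ) *
    Complex.exp (Complex.I * ((z/c : ℝ):ℂ) * w)) c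
  rw [abs_of_pos (inv_pos.mpr hc), Complex.real_smul] at hs
  have hcn : (c:ℂ) ≠ 0 := by exact_mod_cast hc.ne'
  have e : ∀ y : ℝ, ((c * KAiryR (-c * y / 2) (c * y / 2) : ℝ) : ℂ) *
        Complex.exp (Complex.I * (z:ℂ) * (y:ℂ)) = (c:ℂ) * (((KAiryR (-((c*y)/2)) ((c*y)/2) : ℝ) : ℂ) *
    Complex.exp (Complex.I * ((z/c : ℝ):ℂ) * ((c * y : ℝ):ℂ))) := by
    intro y
    rw [show -c * y / 2 = -((c*y)/2) by ring]
    have : Complex.I * ((z/c : ℝ):ℂ) * ((c * y : ℝ):ℂ) = Complex.I * (z:ℂ) * (y:ℂ) := by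
      push_cast; field_simp
    rw [this]; push_cast; ring
  simp only [e]
  rw [integral_const_mul, hs]
  push_cast
  field_simp
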